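/- Every vertex-transitive equivelar map of Schläfli type {7,3} is either regular or chiral. -/

import Mathlib

/-- A map: a finite nonempty set of flags with three fixed-point-free involutions
`s0, s1, s2` such that `s0 * s2` is also a fixed-point-free involution and the
group generated by them acts transitively on the flags. -/
structure CMap (F : Type) [Fintype F] where
  nonempty : Nonempty F
  s0 : Equiv.Perm F
  s1 : Equiv.Perm F
  s2 : Equiv.Perm F
  invol0 : s0 * s0 = 1
  invol1 : s1 * s1 = 1
  invol2 : s2 * s2 = 1
  fpf0 : ∀ x, s0 x ≠ x
  fpf1 : ∀ x, s1 x ≠ x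
  fpf2 : ∀ x, s2 x ≠ x
  invol02 : (s0 * s2) * (s0 * s2) = 1
  fpf02 : ∀ x, s0 (s2 x) ≠ x
  conn : ∀ x y : F, ∃ g ∈ Subgroup.closure ({s0, s1, s2} : Set (Equiv.Perm F)), g x = y

namespace CMap

variable {F : Type} [Fintype F]

/-- The automorphism group of a map: all permutations of the flags commuting
with each of `s0, s1, s2`. -/
def aut (M : CMap F) : Subgroup (Equiv.Perm F) :=
  Subgroup.centralizer {M.s0, M.s1, M.s2}

/-- The vertex containing a flag `x`: the orbit of `x` under `⟨s1, s2⟩`. -/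
def vertexOf (M : CMap F) (x : F) : Set F :=
  MulAction.orbit (Subgroup.closure ({M.s1, M.s2} : Set (Equiv.Perm F))) x

/-- The edge containing a flag `x`: the orbit of `x` under `⟨s0, s2⟩`. -/
def edgeOf (M : CMap F) (x : F) : Set F :=
  MulAction.orbit (Subgroup.closure ({M.s0, M.s2} : Set (Equiv.Perm F))) x

/-- The face containing a flag `x`: the orbit of `x` under `⟨s0, s1⟩`. -/
def faceOf (M : CMap F) (x : F) : Set F :=
  MulAction.orbit (Subgroup.closure ({M.s0, M.s1} : Set (Equiv.Perm F))) x

/-- The orbit of a flag under the automorphism group. -/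
def flagOrbit (M : CMap F) (x : F) : Set F :=
  MulAction.orbit M.aut x

noncomputable def numVertices (M : CMap F) : ℕ := Nat.card (Set.range M.vertexOf)

noncomputable def numEdges (M : CMap F) : ℕ := Nat.card (Set.range M.edgeOf)

noncomputable def numFaces (M : CMap F) : ℕ := Nat.card (Set.range M.faceOf)

/-- The Euler characteristic `V - E + F` of a map. -/
noncomputable def euler (M : CMap F) : ℤ :=
  (M.numVertices : ℤ) - (M.numEdges : ℤ) + (M.numFaces : ℤ)

/-- The number of orbits of the automorphism group on flags. -/
noncomputable def numFlagOrbits (M : CMap F) : ℕ := Nat.card (Set.range M.flagOrbit)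

/-- `M` is a `k`-orbit map if its automorphism group has exactly `k` orbits on flags. -/
def IsKOrbit (M : CMap F) (k : ℕ) : Prop := M.numFlagOrbits = k

/-- A map is regular if it is a 1-orbit map. -/
def IsRegular (M : CMap F) : Prop := M.IsKOrbit 1

/-- A map is chiral if it is a 2-orbit map in which every flag lies in a
different automorphism orbit from each of its images under `s0, s1, s2`. -/
def IsChiral (M : CMap F) : Prop :=
  M.IsKOrbit 2 ∧ ∀ x : F,
    M.s0 x ∉ M.flagOrbit x ∧ M.s1 x ∉ M.flagOrbit x ∧ M.s2 x ∉ M.flagOrbit x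

/-- A map is vertex-transitive if its automorphism group acts transitively on vertices. -/
def VertexTransitive (M : CMap F) : Prop :=
  ∀ x y : F, ∃ g ∈ M.aut, M.vertexOf (g x) = M.vertexOf y

/-- A map is edge-transitive if its automorphism group acts transitively on edges. -/
def EdgeTransitive (M : CMap F) : Prop :=
  ∀ x y : F, ∃ g ∈ M.aut, M.edgeOf (g x) = M.edgeOf y

/-- `M` is equivelar of Schläfli type `{p, q}`: every face has exactly `2p` flags
and every vertex has exactly `2q` flags. -/
def Equivelar (M : CMap F) (p q : ℕ) : Prop :=
  (∀ x : F, Nat.card (M.faceOf x) = 2 * p) ∧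
  (∀ x : F, Nat.card (M.vertexOf x) = 2 * q)

/-- A map is orientable if the flags can be partitioned into two classes so that
each of `s0, s1, s2` maps each class into the other. -/
def Orientable (M : CMap F) : Prop :=
  ∃ A : Set F,
    (∀ x, M.s0 x ∈ A ↔ x ∉ A) ∧ (∀ x, M.s1 x ∈ A ↔ x ∉ A) ∧ (∀ x, M.s2 x ∈ A ↔ x ∉ A)

end CMap

/-- Two maps are isomorphic if there is a bijection between their flag sets
commuting with the respective involutions. -/
def CMap.Isomorphic {F F' : Type} [Fintype F] [Fintype F'] (M : CMap F) (N : CMap F') : Prop :=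
  ∃ e : F ≃ F',
    (∀ x, e (M.s0 x) = N.s0 (e x)) ∧ (∀ x, e (M.s1 x) = N.s1 (e x)) ∧
    (∀ x, e (M.s2 x) = N.s2 (e x))

open Function Set

/-- Two fixed-point-free involutions `a`, `b` of a finite set act on an orbit of `⟨a, b⟩` with
`2 * p` elements in such a way that `(a * b) ^ p` is trivial on it. -/
theorem Equiv.Perm.iterate_mul_of_card_orbit_closure_pair {F : Type*} [Finite F]
    {a b : Equiv.Perm F} (ha : ∀ x, a (a x) = x) (hb : ∀ x, b (b x) = x)
    (hfa : ∀ x, a x ≠ x) (hfb : ∀ x, b x ≠ x) {p : ℕ} {x : F}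
    (hc : Nat.card (MulAction.orbit (Subgroup.closure ({a, b} : Set (Equiv.Perm F))) x) = 2 * p) :
    (a * b)^[p] x = x := by
  set r : Equiv.Perm F := a * b
  have hr_apply (y : F) : r y = a (b y) := rfl
  have conj (k : ℤ) (y : F) : a ((r ^ k) y) = (r ^ (-k)) (a y) := by
    have h : SemiconjBy a r r⁻¹ := by
      ext y
      simp only [Equiv.Perm.mul_apply, hr_apply, ha]
      rw [eq_comm, Equiv.Perm.inv_eq_iff_eq]
      simp [hr_apply, hb]
    have h' := DFunLike.congr_fun (h.zpow_right k).eq y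
    simpa using h'
  let A : Set F := range fun k : ℤ => (r ^ k) x
  have hA : A = MulAction.orbit (Subgroup.zpowers r) x := by
    ext y
    constructor
    · rintro ⟨k, rfl⟩
      exact ⟨⟨r ^ k, k, rfl⟩, rfl⟩
    · rintro ⟨⟨_, k, rfl⟩, rfl⟩
      exact ⟨k, rfl⟩
  have hAcard : A.ncard = minimalPeriod r x := by
    have := Fintype.ofFinite (MulAction.orbit (Subgroup.zpowers r) x)
    rw [hA, ← Nat.card_coe_set_eq, Nat.card_eq_fintype_card]
    exact (MulAction.minimalPeriod_eq_card (a := r) (b := x)).symm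
  have hdisj : _root_.Disjoint A (a '' A) := by
    rw [Set.disjoint_left]
    rintro _ ⟨k, rfl⟩ ⟨_, ⟨l, rfl⟩, h⟩
    simp only [conj] at h
    have h1 : a x = (r ^ (l + k)) x := by
      rw [zpow_add, Equiv.Perm.mul_apply, ← h, ← Equiv.Perm.mul_apply, ← zpow_add]; simp
    obtain ⟨j, hj | hj⟩ := Int.even_or_odd' (l + k)
    · apply hfa ((r ^ j) x)
      rw [conj, h1, ← Equiv.Perm.mul_apply, ← zpow_add, hj]
      congr 2; ring
    · apply hfb ((r ^ j) x)
      have : b ((r ^ j) x) = a ((r ^ (1 + j)) x) := by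
        rw [zpow_add, Equiv.Perm.mul_apply, zpow_one, hr_apply, ha]
      rw [this, conj, h1, ← Equiv.Perm.mul_apply, ← zpow_add, hj]
      congr 2; ring
  have hSa' : ∀ y ∈ A ∪ a '' A, a y ∈ A ∪ a '' A := by
    rintro y (h | ⟨z, h, rfl⟩)
    · exact Or.inr ⟨y, h, rfl⟩
    · exact Or.inl (by rwa [ha])
  have hSr : ∀ y ∈ A ∪ a '' A, r y ∈ A ∪ a '' A := by
    rintro _ (⟨k, rfl⟩ | ⟨_, ⟨k, rfl⟩, rfl⟩)
    · exact Or.inl ⟨1 + k, by simp [zpow_add]⟩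
    · refine Or.inr ⟨_, ⟨-1 + k, rfl⟩, ?_⟩
      simp only [conj]
      rw [neg_add, zpow_add]; simp
  have hSb' : ∀ y ∈ A ∪ a '' A, b y ∈ A ∪ a '' A := fun y hy => by
    simpa [hr_apply, ha] using hSa' _ (hSr y hy)
  have horb : MulAction.orbit (Subgroup.closure ({a, b} : Set (Equiv.Perm F))) x = A ∪ a '' A := by
    apply Subset.antisymm
    · have key : ∀ g ∈ Subgroup.closure ({a, b} : Set (Equiv.Perm F)),
          ∀ y, g y ∈ A ∪ a '' A ↔ y ∈ A ∪ a '' A := by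
        intro g hg
        induction hg using Subgroup.closure_induction with
        | mem g hg =>
          rcases hg with rfl | rfl
          · exact fun y => ⟨fun h => by simpa only [ha] using hSa' _ h, hSa' y⟩
          · exact fun y => ⟨fun h => by simpa only [hb] using hSb' _ h, hSb' y⟩
        | one => exact fun y => Iff.rfl
        | mul g h _ _ hg hh => exact fun y => (hg (h y)).trans (hh y)
        | inv g _ hg => exact fun y => by rw [← hg]; simp
      rintro _ ⟨g, rfl⟩
      exact (key g g.2 x).2 (Or.inl ⟨0, by simp⟩)
    · have ma : a ∈ Subgroup.closure ({a, b} : Set (Equiv.Perm F)) :=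
        Subgroup.subset_closure (by simp)
      have mr : r ∈ Subgroup.closure ({a, b} : Set (Equiv.Perm F)) :=
        mul_mem ma (Subgroup.subset_closure (by simp))
      rintro _ (⟨k, rfl⟩ | ⟨_, ⟨k, rfl⟩, rfl⟩)
      · exact ⟨⟨r ^ k, zpow_mem mr k⟩, rfl⟩
      · exact ⟨⟨a * r ^ k, mul_mem ma (zpow_mem mr k)⟩, rfl⟩
  have hp : minimalPeriod r x = p := by
    rw [horb, Nat.card_coe_set_eq, ncard_union_eq hdisj, ncard_image_of_injective _ a.injective,
      hAcard] at hc
    omega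
  rw [← hp]
  exact isPeriodicPt_minimalPeriod r x

/-- A point of prime period `p` whose orbit stays in a set with fewer than `p` elements is
fixed. -/
theorem Function.IsPeriodicPt.isFixedPt_of_ncard_lt {α : Type*} {f : α → α} {p : ℕ}
    (hp : p.Prime) {t : α} (ht : IsPeriodicPt f p t) {S : Set α} (hS : S.Finite)
    (hmem : ∀ n, f^[n] t ∈ S) (hcard : S.ncard < p) : f t = t := by
  rcases (Nat.dvd_prime hp).1 ht.minimalPeriod_dvd with h | h
  · exact minimalPeriod_eq_one_iff_isFixedPt.1 h
  · have := ncard_le_ncard_of_injOn (s := Iio (minimalPeriod f t)) (fun n => f^[n] t)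
      (fun n _ => hmem n) iterate_injOn_Iio_minimalPeriod hS
    rw [h] at this
    simp at this
    omega

namespace CMap

variable {F : Type} [Fintype F] (M : CMap F)

theorem s0_s0 (x : F) : M.s0 (M.s0 x) = x := DFunLike.congr_fun M.invol0 x

theorem s1_s1 (x : F) : M.s1 (M.s1 x) = x := DFunLike.congr_fun M.invol1 x

theorem s2_s2 (x : F) : M.s2 (M.s2 x) = x := DFunLike.congr_fun M.invol2 x

variable {M}

theorem mem_aut_iff {g : Equiv.Perm F} : g ∈ M.aut ↔
    (∀ x, g (M.s0 x) = M.s0 (g x)) ∧ (∀ x, g (M.s1 x) = M.s1 (g x)) ∧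
      ∀ x, g (M.s2 x) = M.s2 (g x) := by
  simp only [aut, Subgroup.mem_centralizer_iff, mem_insert_iff, mem_singleton_iff,
    forall_eq_or_imp, forall_eq]
  simp only [Equiv.ext_iff, Equiv.Perm.mul_apply, eq_comm]

theorem flagOrbit_eq_iff {x y : F} : M.flagOrbit x = M.flagOrbit y ↔ ∃ g ∈ M.aut, g y = x := by
  rw [flagOrbit, flagOrbit, MulAction.orbit_eq_iff]
  exact ⟨fun ⟨g, h⟩ => ⟨g, g.2, h⟩, fun ⟨g, hg, h⟩ => ⟨⟨g, hg⟩, h⟩⟩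

theorem mem_flagOrbit_iff {x y : F} : x ∈ M.flagOrbit y ↔ M.flagOrbit x = M.flagOrbit y :=
  MulAction.orbit_eq_iff.symm

theorem flagOrbit_s0_congr {x y : F} (h : M.flagOrbit x = M.flagOrbit y) :
    M.flagOrbit (M.s0 x) = M.flagOrbit (M.s0 y) := by
  obtain ⟨g, hg, rfl⟩ := flagOrbit_eq_iff.1 h
  exact flagOrbit_eq_iff.2 ⟨g, hg, (mem_aut_iff.1 hg).1 y⟩

theorem flagOrbit_s1_congr {x y : F} (h : M.flagOrbit x = M.flagOrbit y) :
    M.flagOrbit (M.s1 x) = M.flagOrbit (M.s1 y) := by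
  obtain ⟨g, hg, rfl⟩ := flagOrbit_eq_iff.1 h
  exact flagOrbit_eq_iff.2 ⟨g, hg, (mem_aut_iff.1 hg).2.1 y⟩

theorem flagOrbit_s2_congr {x y : F} (h : M.flagOrbit x = M.flagOrbit y) :
    M.flagOrbit (M.s2 x) = M.flagOrbit (M.s2 y) := by
  obtain ⟨g, hg, rfl⟩ := flagOrbit_eq_iff.1 h
  exact flagOrbit_eq_iff.2 ⟨g, hg, (mem_aut_iff.1 hg).2.2 y⟩

theorem image_flagOrbit (x : F) :
    (M.s0 * M.s1) '' M.flagOrbit x = M.flagOrbit ((M.s0 * M.s1) x) := by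
  ext y
  constructor
  · rintro ⟨z, hz, rfl⟩
    rw [mem_flagOrbit_iff] at hz ⊢
    exact flagOrbit_s0_congr (flagOrbit_s1_congr hz)
  · intro hy
    refine ⟨M.s1 (M.s0 y), ?_, by simp [s0_s0, s1_s1]⟩
    rw [mem_flagOrbit_iff] at hy ⊢
    simpa [s0_s0, s1_s1] using flagOrbit_s1_congr (flagOrbit_s0_congr hy)

theorem Equivelar.iterate_s0_mul_s1 {p q : ℕ} (h : M.Equivelar p q) (x : F) :
    (M.s0 * M.s1)^[p] x = x :=
  Equiv.Perm.iterate_mul_of_card_orbit_closure_pair M.s0_s0 M.s1_s1 M.fpf0 M.fpf1 (h.1 x)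

theorem Equivelar.iterate_s1_mul_s2 {p q : ℕ} (h : M.Equivelar p q) (x : F) :
    (M.s1 * M.s2)^[q] x = x :=
  Equiv.Perm.iterate_mul_of_card_orbit_closure_pair M.s1_s1 M.s2_s2 M.fpf1 M.fpf2 (h.2 x)

/-- A vertex of a vertex-transitive map meets every flag orbit. -/
theorem VertexTransitive.range_flagOrbit_subset (h : M.VertexTransitive) (x : F) :
    range M.flagOrbit ⊆ M.flagOrbit '' M.vertexOf x := by
  rintro _ ⟨y, rfl⟩
  obtain ⟨g, hg, hgy⟩ := h y x
  refine ⟨g y, ?_, flagOrbit_eq_iff.2 ⟨g, hg, rfl⟩⟩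
  rw [← hgy]
  exact MulAction.mem_orbit_self _

theorem VertexTransitive.ncard_range_flagOrbit_le {p q : ℕ} (h : M.VertexTransitive)
    (he : M.Equivelar p q) : (range M.flagOrbit).ncard ≤ 2 * q := by
  obtain ⟨x⟩ := M.nonempty
  rw [← he.2 x, Nat.card_coe_set_eq]
  exact (ncard_le_ncard (h.range_flagOrbit_subset x)).trans (ncard_image_le)

/-- If the type is `{p, q}` with `p` a prime exceeding the number of flag orbits, then `s0` and
`s1` agree on flag orbits. -/
theorem Equivelar.flagOrbit_s0_eq_s1 {p q : ℕ} (hp : p.Prime) (he : M.Equivelar p q)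
    (hlt : (range M.flagOrbit).ncard < p) (x : F) :
    M.flagOrbit (M.s0 x) = M.flagOrbit (M.s1 x) := by
  have hit (n : ℕ) (y : F) : (image (M.s0 * M.s1))^[n] (M.flagOrbit y) =
      M.flagOrbit ((M.s0 * M.s1)^[n] y) :=
    ((Semiconj.iterate_right (fun y => (image_flagOrbit y).symm) n).eq y).symm
  have hper : IsPeriodicPt (image (M.s0 * M.s1)) p (M.flagOrbit (M.s1 x)) := by
    rw [IsPeriodicPt, IsFixedPt, hit, he.iterate_s0_mul_s1]
  have h := hper.isFixedPt_of_ncard_lt hp (finite_range M.flagOrbit)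
    (fun n => ⟨_, (hit n _).symm⟩) hlt
  rw [image_flagOrbit] at h
  simpa [s1_s1] using h

theorem Equivelar.flagOrbit_s1_eq_s2 {p : ℕ} (he : M.Equivelar p 3)
    (h01 : ∀ x, M.flagOrbit (M.s0 x) = M.flagOrbit (M.s1 x)) (x : F) :
    M.flagOrbit (M.s1 x) = M.flagOrbit (M.s2 x) := by
  have hsq (y : F) : M.flagOrbit (M.s1 (M.s2 (M.s1 (M.s2 y)))) = M.flagOrbit y := by
    rw [← h01, flagOrbit_s0_congr (flagOrbit_s2_congr (h01 (M.s2 y)).symm)]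
    exact congrArg M.flagOrbit (DFunLike.congr_fun M.invol02 y)
  have hcube : M.s1 (M.s2 (M.s1 (M.s2 (M.s1 (M.s2 x))))) = x := he.iterate_s1_mul_s2 x
  have h := hsq (M.s1 (M.s2 x))
  rw [hcube] at h
  simpa [s1_s1] using flagOrbit_s1_congr h

theorem isRegular_or_isChiral
    (h01 : ∀ x, M.flagOrbit (M.s0 x) = M.flagOrbit (M.s1 x))
    (h12 : ∀ x, M.flagOrbit (M.s1 x) = M.flagOrbit (M.s2 x)) :
    M.IsRegular ∨ M.IsChiral := by
  have hpair (x y : F) :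
      M.flagOrbit y = M.flagOrbit x ∨ M.flagOrbit y = M.flagOrbit (M.s1 x) := by
    obtain ⟨g, hg, rfl⟩ := M.conn x y
    have key : (∀ y, M.flagOrbit (g y) = M.flagOrbit y) ∨
        ∀ y, M.flagOrbit (g y) = M.flagOrbit (M.s1 y) := by
      induction hg using Subgroup.closure_induction with
      | mem g hg =>
        rcases hg with rfl | rfl | rfl
        · exact Or.inr h01
        · exact Or.inr fun _ => rfl
        · exact Or.inr fun y => (h12 y).symm
      | one => exact Or.inl fun _ => rfl
      | mul g h _ _ hg hh =>
        rcases hg with hg | hg <;> rcases hh with hh | hh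
        · exact Or.inl fun y => (hg _).trans (hh y)
        · exact Or.inr fun y => (hg _).trans (hh y)
        · exact Or.inr fun y => (hg _).trans (flagOrbit_s1_congr (hh y))
        · refine Or.inl fun y => (hg _).trans ((flagOrbit_s1_congr (hh y)).trans ?_)
          rw [s1_s1]
      | inv g _ hg =>
        rcases hg with hg | hg
        · refine Or.inl fun y => ?_
          rw [← hg]; simp
        · refine Or.inr fun y => ?_
          have := flagOrbit_s1_congr (hg (g⁻¹ y))
          simpa [s1_s1] using this.symm
    exact key.imp (fun h => h x) fun h => h x
  obtain ⟨x⟩ := M.nonempty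
  have hrange (x : F) : range M.flagOrbit = {M.flagOrbit x, M.flagOrbit (M.s1 x)} := by
    apply Subset.antisymm
    · rintro _ ⟨y, rfl⟩
      exact hpair x y
    · rintro _ (rfl | rfl) <;> exact mem_range_self _
  by_cases h : ∃ x, M.flagOrbit (M.s1 x) = M.flagOrbit x
  · obtain ⟨x, hx⟩ := h
    left
    rw [IsRegular, IsKOrbit, numFlagOrbits, Nat.card_coe_set_eq, hrange x, hx]
    simp
  · push Not at h
    right
    refine ⟨?_, fun y => ?_⟩
    · rw [IsKOrbit, numFlagOrbits, Nat.card_coe_set_eq, hrange x, ncard_pair (h x).symm]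
    · simp only [mem_flagOrbit_iff, h01, ← h12]
      exact ⟨h y, h y, h y⟩

end CMap

/-- Every vertex-transitive equivelar map of Schläfli type `{7, 3}`
is regular or chiral. -/
theorem stmt_4 {F : Type} [Fintype F] (M : CMap F)
    (heq : M.Equivelar 7 3) (hvt : M.VertexTransitive) :
    M.IsRegular ∨ M.IsChiral := by
  have h01 := heq.flagOrbit_s0_eq_s1 (by norm_num)
    ((hvt.ncard_range_flagOrbit_le heq).trans_lt (by norm_num))
  exact CMap.isRegular_or_isChiral h01 (heq.flagOrbit_s1_eq_s2 h01)
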